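/- Assume gcd(I, J, n) = 1, I ≠ J, and that the polynomial P^{I,J}_{α,β,γ}(X) has no roots in F_{q^n}. Then there exist infinitely many positive integers ℓ such that the F_q-subspace U_ℓ := {(x, y, x^{q^I} + α·y^{q^J}, x^{q^J} + β·y^{q^I} + γ·y^{q^J}) : x, y ∈ F_{q^{nℓ}}} of F_{q^{nℓ}}^4 is scattered and indecomposable, i.e., there do not exist nonzero F_{q^{nℓ}}-subspaces V_1, V_2 of F_{q^{nℓ}}^4 with F_{q^{nℓ}}^4 = V_1 ⊕ V_2, U_ℓ = (U_ℓ ∩ V_1) + (U_ℓ ∩ V_2), and with dim_{F_q}(U_ℓ ∩ V_1) and dim_{F_q}(U_ℓ ∩ V_2) both positive multiples of nℓ. Here F_{q^{nℓ}} denotes the degree-ℓ extension of F_{q^n} inside a fixed algebraic closure. -/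

import Mathlib

open Module

namespace ScatteredSeq

variable (q : ℕ) (Fq : Type*) [Field Fq] [Fintype Fq] {Fqn : Type*} [Field Fqn]
  [Algebra Fq Fqn]

theorem frob_add (hq : Fintype.card Fq = q) (t : ℕ) (a b : Fqn) :
    (a + b) ^ q ^ t = a ^ q ^ t + b ^ q ^ t := by
  obtain ⟨p, hp⟩ := CharP.exists Fq
  haveI : CharP Fqn p := charP_of_injective_algebraMap (algebraMap Fq Fqn).injective p
  obtain ⟨k, hprime, hcard⟩ := FiniteField.card Fq p
  haveI : Fact p.Prime := ⟨hprime⟩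
  subst hq
  rw [hcard, ← pow_mul]
  exact add_pow_char_pow a b p _

theorem frob_algebraMap (hq : Fintype.card Fq = q) (t : ℕ) (c : Fq) :
    (algebraMap Fq Fqn c) ^ q ^ t = algebraMap Fq Fqn c := by
  rw [← map_pow]
  congr 1
  subst hq
  exact FiniteField.pow_card_pow t c

/-- The vector `(x, y, x^{q^I} + α y^{q^J}, x^{q^J} + β y^{q^I} + γ y^{q^J})`. -/
def Uvec (α β γ : Fqn) (I J : ℕ) (x y : Fqn) : Fin 4 → Fqn :=
  ![x, y, x ^ q ^ I + α * y ^ q ^ J, x ^ q ^ J + β * y ^ q ^ I + γ * y ^ q ^ J]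

/-- The `F_q`-subspace `U^{I,J,n}_{α,β,γ}` of `F_{q^n}^4`. -/
def Uspace (hq : Fintype.card Fq = q) (α β γ : Fqn) (I J : ℕ) :
    Submodule Fq (Fin 4 → Fqn) where
  carrier := {w | ∃ x y : Fqn, w = Uvec q α β γ I J x y}
  zero_mem' := by
    have hq0 : q ≠ 0 := by subst hq; exact Fintype.card_ne_zero
    exact ⟨0, 0, by funext i; fin_cases i <;>
      simp [Uvec, zero_pow (pow_ne_zero _ hq0)]⟩
  add_mem' := by
    rintro a b ⟨x₁, y₁, rfl⟩ ⟨x₂, y₂, rfl⟩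
    refine ⟨x₁ + x₂, y₁ + y₂, ?_⟩
    funext i
    fin_cases i <;>
      simp [Uvec, frob_add q Fq hq, mul_add] <;> ring
  smul_mem' := by
    rintro c w ⟨x, y, rfl⟩
    refine ⟨c • x, c • y, ?_⟩
    funext i
    fin_cases i <;>
      simp [Uvec, Algebra.smul_def, mul_pow, frob_algebraMap q Fq hq] <;> ring

/-- An `F_q`-subspace of `F_{q^n}^k` is scattered if it meets every `F_{q^n}`-line in
an `F_q`-subspace of dimension at most `1`. -/
def IsScattered {k : ℕ} (U : Submodule Fq (Fin k → Fqn)) : Prop :=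
  ∀ H : Submodule Fqn (Fin k → Fqn), finrank Fqn H = 1 →
    finrank Fq ↥(U ⊓ H.restrictScalars Fq) ≤ 1

/-- The polynomial `P^{I,J}_{α,β,γ}` has no roots in `F_{q^n}`. -/
def PHasNoRoot (α β γ : Fqn) (I J : ℕ) : Prop :=
  if I < J then ∀ x : Fqn, x ^ (q ^ (J - I) + 1) + γ * x - α * β ≠ 0
  else ∀ x : Fqn, x ^ (q ^ (I - J) + 1) + γ * x ^ q ^ (I - J) - α * β ≠ 0

end ScatteredSeq

open ScatteredSeq Module

namespace ScatteredSeq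

section Semilinear

variable {K L : Type*} [Field K] [Fintype K] [Field L] [Algebra K L]

theorem exists_algebraMap_eq_of_pow_card_eq {x : L} (hx : x ^ Fintype.card K = x) :
    ∃ c : K, algebraMap K L c = x := by
  classical
  have hp := FiniteField.X_pow_card_sub_X_ne_zero L (Fintype.one_lt_card (α := K))
  have hd := FiniteField.X_pow_card_sub_X_natDegree_eq L (Fintype.one_lt_card (α := K))
  set p : Polynomial L := Polynomial.X ^ Fintype.card K - Polynomial.X with hpdef
  have hsub : Finset.univ.image (algebraMap K L) ⊆ p.roots.toFinset := by
    intro y hy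
    obtain ⟨c, -, rfl⟩ := Finset.mem_image.1 hy
    rw [Multiset.mem_toFinset, Polynomial.mem_roots hp]
    simp [hpdef, ← map_pow, FiniteField.pow_card]
  have hcard : p.roots.toFinset.card ≤ (Finset.univ.image (algebraMap K L)).card := by
    rw [Finset.card_image_of_injective _ (algebraMap K L).injective, Finset.card_univ, ← hd]
    exact (Multiset.toFinset_card_le _).trans (Polynomial.card_roots' p)
  have hmem : x ∈ p.roots.toFinset := by
    rw [Multiset.mem_toFinset, Polynomial.mem_roots hp]
    simp [hpdef, hx]
  rw [← Finset.eq_of_subset_of_card_le hsub hcard] at hmem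
  obtain ⟨c, -, hc⟩ := Finset.mem_image.1 hmem
  exact ⟨c, hc⟩

/-- Solutions of a first order Frobenius system `v ^ q = A v` that are independent over the
field with `q` elements are independent over the large field. -/
theorem linearIndependent_of_frobenius_eq [Finite L] {ι : Type*} (A : (ι → L) →ₗ[L] (ι → L))
    {m : ℕ} (v : Fin m → ι → L)
    (hv : ∀ j, (fun i => v j i ^ Fintype.card K) = A (v j)) (hli : LinearIndependent K v) :
    LinearIndependent L v := by
  induction m with
  | zero => exact linearIndependent_empty_type
  | succ m ih =>
    rw [← Fin.cons_self_tail v, linearIndependent_finCons] at hli ⊢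
    have htail := ih (Fin.tail v) (fun j => hv j.succ) hli.1
    refine ⟨htail, fun hmem => hli.2 ?_⟩
    obtain ⟨c, hc⟩ := (Submodule.mem_span_range_iff_exists_fun L).1 hmem
    have : Algebra.IsAlgebraic K L := inferInstance
    let φ := FiniteField.frobeniusAlgEquivOfAlgebraic K L
    have hφ (x : L) : φ x = x ^ Fintype.card K := rfl
    have hv' (j i) : φ (v j i) = A (v j) i := congrFun (hv j) i
    have hsymm : ∑ i, φ.symm (c i) • Fin.tail v i = v 0 := by
      funext i
      apply φ.injective
      have h0 : A (v 0) i = ∑ j, c j * φ (Fin.tail v j i) := by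
        rw [← hc, map_sum, Finset.sum_apply]
        refine Finset.sum_congr rfl fun j _ => ?_
        rw [map_smul, Pi.smul_apply, smul_eq_mul]
        congr 1
        exact (hv' j.succ i).symm
      rw [hv', h0, Finset.sum_apply, map_sum]
      simp
    have heq : ∀ j, φ.symm (c j) = c j := by
      have h := Fintype.linearIndependent_iff.1 htail (fun j => φ.symm (c j) - c j) (by
        simp only [sub_smul, Finset.sum_sub_distrib]
        rw [hsymm, hc, sub_self])
      exact fun j => sub_eq_zero.1 (h j)
    have hfix (j) : ∃ a : K, algebraMap K L a = c j := by
      apply exists_algebraMap_eq_of_pow_card_eq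
      rw [← hφ]
      conv_lhs => rw [← heq j]
      simp
    choose a ha using hfix
    refine (Submodule.mem_span_range_iff_exists_fun K).2 ⟨a, ?_⟩
    rw [← hc]
    refine Finset.sum_congr rfl fun j _ => ?_
    rw [← ha j, algebraMap_smul]

/-- The solution space of a Frobenius system of order `M` in unknowns indexed by `κ` has dimension
at most `M * card κ`. -/
theorem finrank_le_of_frobenius_system [Finite L] {κ E : Type*} [Fintype κ] [AddCommGroup E]
    [Module K E] {M : ℕ} (hM : 0 < M) (T : E →ₗ[K] (κ → L))
    (hT : Function.Injective T) (A : (Fin M × κ → L) →ₗ[L] (κ → L))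
    (hA : ∀ e, (fun i => T e i ^ Fintype.card K ^ M)
      = A fun p => T e p.2 ^ Fintype.card K ^ (p.1 : ℕ)) :
    finrank K E ≤ M * Fintype.card κ := by
  have : Module.Finite K L := Module.Finite.of_finite
  have : Module.Finite K E := Module.Finite.of_injective T hT
  let D : E →ₗ[K] (Fin M × κ → L) := LinearMap.pi fun p =>
    ((FiniteField.frobeniusAlgHom K L ^ (p.1 : ℕ)).toLinearMap ∘ₗ LinearMap.proj p.2) ∘ₗ T
  have hD (e p) : D e p = T e p.2 ^ Fintype.card K ^ (p.1 : ℕ) := by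
    simp [D, AlgHom.coe_pow, FiniteField.coe_frobeniusAlgHom, pow_iterate]
  have hDinj : Function.Injective D := by
    intro e f hef
    apply hT
    funext i
    have := congrFun hef (⟨0, hM⟩, i)
    simpa [hD] using this
  let C : (Fin M × κ → L) →ₗ[L] (Fin M × κ → L) := LinearMap.pi fun p =>
    if h : (p.1 : ℕ) + 1 < M then LinearMap.proj (⟨p.1 + 1, h⟩, p.2)
    else LinearMap.proj p.2 ∘ₗ A
  have hC (e) : (fun p => D e p ^ Fintype.card K) = C (D e) := by
    funext p
    rw [hD, ← pow_mul, ← pow_succ]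
    by_cases h : (p.1 : ℕ) + 1 < M
    · simp [C, h, hD]
    · have hp : (p.1 : ℕ) + 1 = M := by omega
      have hDe : D e = fun p => T e p.2 ^ Fintype.card K ^ (p.1 : ℕ) := funext (hD e)
      simp only [C, LinearMap.pi_apply, h, dite_false, LinearMap.comp_apply,
        LinearMap.proj_apply]
      rw [hDe, ← hA, hp]
  let b := Module.finBasis K E
  have hli : LinearIndependent K (D ∘ b) :=
    b.linearIndependent.map' D (LinearMap.ker_eq_bot.2 hDinj)
  have := (linearIndependent_of_frobenius_eq C (D ∘ b) (fun j => hC (b j))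
    hli).fintype_card_le_finrank
  simpa using this

end Semilinear

section Uspace

variable {K L : Type*} [Field K] [Fintype K] [Field L] {α β γ : L} {I J : ℕ}

local notation "q" => Fintype.card K

theorem PHasNoRoot.det_ne_zero (hP : PHasNoRoot q α β γ I J) {x y : L}
    (hxy : x ≠ 0 ∨ y ≠ 0) :
    x ^ q ^ I * (x ^ q ^ J + γ * y ^ q ^ J) - α * β * (y ^ q ^ I * y ^ q ^ J) ≠ 0 := by
  have hq0 : q ≠ 0 := Fintype.card_ne_zero
  by_cases hy : y = 0
  · subst hy
    have hx : x ≠ 0 := by simpa using hxy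
    simp [zero_pow (pow_ne_zero _ hq0), hx]
  · have hfac : x ^ q ^ I * (x ^ q ^ J + γ * y ^ q ^ J) - α * β * (y ^ q ^ I * y ^ q ^ J)
        = y ^ q ^ I * y ^ q ^ J *
          ((x / y) ^ q ^ I * (x / y) ^ q ^ J + γ * (x / y) ^ q ^ I - α * β) := by
      have h1 : y ^ q ^ I ≠ 0 := pow_ne_zero _ hy
      have h2 : y ^ q ^ J ≠ 0 := pow_ne_zero _ hy
      rw [div_pow, div_pow]
      field_simp
    rw [hfac]
    refine mul_ne_zero (mul_ne_zero (pow_ne_zero _ hy) (pow_ne_zero _ hy)) ?_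
    generalize x / y = t
    unfold PHasNoRoot at hP
    split_ifs at hP with h
    · have := hP (t ^ q ^ I)
      rwa [pow_succ (t ^ q ^ I), ← pow_mul, ← pow_add q, Nat.add_sub_cancel' h.le,
        mul_comm (t ^ q ^ J)] at this
    · have := hP (t ^ q ^ J)
      rwa [pow_succ (t ^ q ^ J), ← pow_mul, ← pow_add q, Nat.add_sub_cancel' (not_lt.1 h)] at this

variable [Algebra K L]

theorem isScattered_Uspace [Finite L] (hP : PHasNoRoot q α β γ I J)
    (hgcd : Nat.gcd (Nat.gcd I J) (finrank K L) = 1) :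
    IsScattered K (Uspace q K rfl α β γ I J) := by
  classical
  have : Module.Finite K L := Module.Finite.of_finite
  have hq0 : q ≠ 0 := Fintype.card_ne_zero
  intro H hH
  by_cases hbot : Uspace q K rfl α β γ I J ⊓ H.restrictScalars K = ⊥
  · rw [hbot]
    simp
  obtain ⟨v, ⟨hvU, hvH⟩, hv0⟩ := Submodule.exists_mem_ne_zero_of_ne_bot hbot
  refine finrank_le_one ⟨v, hvU, hvH⟩ ?_
  rintro ⟨w, hwU, hwH⟩
  obtain ⟨l, hl⟩ := (finrank_eq_one_iff_of_nonzero' (⟨v, hvH⟩ : H)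
    (by simpa [Subtype.ext_iff] using hv0)).1 hH ⟨w, hwH⟩
  have hl' : l • v = w := congrArg Subtype.val hl
  obtain ⟨x, y, rfl⟩ := hvU
  obtain ⟨x', y', rfl⟩ := hwU
  have e0 : l * x = x' := by simpa [Uvec] using congrFun hl' 0
  have e1 : l * y = y' := by simpa [Uvec] using congrFun hl' 1
  have e2 : l * (x ^ q ^ I + α * y ^ q ^ J) = x' ^ q ^ I + α * y' ^ q ^ J := by
    simpa [Uvec] using congrFun hl' 2
  have e3 : l * (x ^ q ^ J + β * y ^ q ^ I + γ * y ^ q ^ J)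
      = x' ^ q ^ J + β * y' ^ q ^ I + γ * y' ^ q ^ J := by
    simpa [Uvec] using congrFun hl' 3
  rw [← e0, ← e1] at e2 e3
  simp only [mul_pow] at e2 e3
  have hxy : x ≠ 0 ∨ y ≠ 0 := by
    by_contra! h
    obtain ⟨rfl, rfl⟩ := h
    apply hv0
    funext i
    fin_cases i <;> simp [Uvec, zero_pow (pow_ne_zero _ hq0)]
  have hdet := hP.det_ne_zero hxy
  have hI : l ^ q ^ I = l := by
    rw [← sub_eq_zero]
    refine (mul_eq_zero.1 ?_).resolve_right hdet
    linear_combination (-(x ^ q ^ J + γ * y ^ q ^ J)) * e2 + α * y ^ q ^ J * e3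
  have hJ : l ^ q ^ J = l := by
    rw [← sub_eq_zero]
    refine (mul_eq_zero.1 ?_).resolve_right hdet
    linear_combination (-(x ^ q ^ I)) * e3 + β * y ^ q ^ I * e2
  have hN : l ^ q ^ finrank K L = l := by
    have := Fintype.ofFinite L
    rw [← Module.card_eq_pow_finrank (K := K) (V := L)]
    exact FiniteField.pow_card l
  have hper (k : ℕ) (h : l ^ q ^ k = l) : Function.IsPeriodicPt (fun z : L => z ^ q) k l := by
    rw [Function.IsPeriodicPt, Function.IsFixedPt, pow_iterate]
    exact h
  have h1 := ((hper I hI).gcd (hper J hJ)).gcd (hper _ hN)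
  rw [hgcd] at h1
  obtain ⟨c, hc⟩ := exists_algebraMap_eq_of_pow_card_eq (K := K) (x := l) h1
  refine ⟨c, Subtype.ext ?_⟩
  change c • Uvec q α β γ I J x y = Uvec q α β γ I J x' y'
  rw [← hl', ← hc, algebraMap_smul]

theorem finrank_Uspace_inf_le_of_eq_graph [Finite L] (hα : α ≠ 0) (hβ : β ≠ 0)
    (hI : 0 < I) (hIJ : I ≠ J) {V : Submodule L (Fin 4 → L)}
    (G : (Fin 2 → L) →ₗ[L] (Fin 4 → L)) (hG : ∀ w ∈ V, G ![w 0, w 1] = w) :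
    finrank K ↥(Uspace q K rfl α β γ I J ⊓ V.restrictScalars K) ≤ max I J * 2 := by
  let T : ↥(Uspace q K rfl α β γ I J ⊓ V.restrictScalars K) →ₗ[K] (Fin 2 → L) :=
    LinearMap.pi (fun i => LinearMap.proj (![0, 1] i : Fin 4)) ∘ₗ Submodule.subtype _
  have hTe (e) : T e = ![e.1 0, e.1 1] := by
    funext i
    fin_cases i <;> rfl
  have hT : Function.Injective T := by
    intro e f hef
    rw [hTe, hTe] at hef
    apply Subtype.ext
    rw [← hG e e.2.2, ← hG f f.2.2, hef]
  have hM : 0 < max I J := lt_max_of_lt_left hI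
  have key (A : (Fin (max I J) × Fin 2 → L) →ₗ[L] (Fin 2 → L))
      (hA : ∀ x y : L, (G ![x, y]) 2 = x ^ q ^ I + α * y ^ q ^ J →
        (G ![x, y]) 3 = x ^ q ^ J + β * y ^ q ^ I + γ * y ^ q ^ J →
        A (fun p => ![x, y] p.2 ^ q ^ (p.1 : ℕ)) = ![x ^ q ^ max I J, y ^ q ^ max I J]) :
      finrank K ↥(Uspace q K rfl α β γ I J ⊓ V.restrictScalars K) ≤ max I J * 2 := by
    refine (finrank_le_of_frobenius_system hM T hT A ?_).trans_eq (by simp)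
    rintro ⟨w, ⟨x, y, rfl⟩, hwV⟩
    have hGw := hG _ hwV
    have hxy : T ⟨Uvec q α β γ I J x y, ⟨x, y, rfl⟩, hwV⟩ = ![x, y] := hTe _
    rw [hxy, hA x y (congrFun hGw 2) (congrFun hGw 3)]
    funext i
    fin_cases i <;> rfl
  let z : (Fin (max I J) × Fin 2 → L) →ₗ[L] (Fin 2 → L) :=
    LinearMap.pi fun i => LinearMap.proj (⟨0, hM⟩, i)
  have hz (x y : L) : z (fun p => ![x, y] p.2 ^ q ^ (p.1 : ℕ)) = ![x, y] := by
    funext i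
    simp [z]
  let g (i : Fin 4) : (Fin (max I J) × Fin 2 → L) →ₗ[L] L := LinearMap.proj i ∘ₗ G ∘ₗ z
  have hg (i : Fin 4) (x y : L) :
      g i (fun p => ![x, y] p.2 ^ q ^ (p.1 : ℕ)) = G ![x, y] i := by
    simp only [g, LinearMap.comp_apply, hz, LinearMap.proj_apply]
  rcases lt_or_gt_of_ne hIJ with h | h
  · have hI' : I < max I J := lt_max_of_lt_right h
    let P (i : Fin 2) : (Fin (max I J) × Fin 2 → L) →ₗ[L] L := LinearMap.proj (⟨I, hI'⟩, i)
    let Y := α⁻¹ • (g 2 - P 0)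
    refine key (LinearMap.pi ![g 3 - β • P 1 - γ • Y, Y]) fun x y h2 h3 => ?_
    have hY : Y (fun p => ![x, y] p.2 ^ q ^ (p.1 : ℕ)) = y ^ q ^ J := by
      simp only [Y, P, LinearMap.smul_apply, LinearMap.sub_apply, hg, h2, LinearMap.proj_apply]
      simp [hα]
    rw [show q ^ max I J = q ^ J by rw [max_eq_right h.le]]
    funext i
    fin_cases i
    · simp [hY, hg, h3, P]
      ring
    · simp [hY]
  · have hJ' : J < max I J := lt_max_of_lt_left h
    let P (i : Fin 2) : (Fin (max I J) × Fin 2 → L) →ₗ[L] L := LinearMap.proj (⟨J, hJ'⟩, i)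
    refine key (LinearMap.pi ![g 2 - α • P 1, β⁻¹ • (g 3 - P 0 - γ • P 1)])
      fun x y h2 h3 => ?_
    rw [show q ^ max I J = q ^ I by rw [max_eq_left h.le]]
    funext i
    fin_cases i
    · simp [hg, h2, P]
    · simp only [P, LinearMap.pi_apply]
      simp [hg, h3]
      field_simp
      ring

theorem finrank_Uspace_inf_le_of_line [Finite L] (hP : PHasNoRoot q α β γ I J)
    (hI : 0 < I) (hJ : 0 < J) (hIJ : I ≠ J) {V : Submodule L (Fin 4 → L)} {x₀ y₀ c d e : L}
    (hxy : x₀ ≠ 0 ∨ y₀ ≠ 0) (hcd : c ≠ 0 ∨ d ≠ 0)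
    (hV : ∀ w ∈ V, ∃ l : L, w 0 = l * x₀ ∧ w 1 = l * y₀ ∧ c * w 2 + d * w 3 = l * e) :
    finrank K ↥(Uspace q K rfl α β γ I J ⊓ V.restrictScalars K) ≤ max I J := by
  classical
  have hq1 : 1 < q := Fintype.one_lt_card
  have hdet := hP.det_ne_zero hxy
  set a := c * x₀ ^ q ^ I + d * β * y₀ ^ q ^ I with ha
  set b := c * α * y₀ ^ q ^ J + d * (x₀ ^ q ^ J + γ * y₀ ^ q ^ J) with hb
  have hab : a ≠ 0 ∨ b ≠ 0 := by
    by_contra! h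
    obtain ⟨h1, h2⟩ := h
    have hc : c = 0 := by
      refine (mul_eq_zero.1 ?_).resolve_right hdet
      linear_combination (x₀ ^ q ^ J + γ * y₀ ^ q ^ J) * (ha.symm.trans h1)
        - β * y₀ ^ q ^ I * (hb.symm.trans h2)
    have hd : d = 0 := by
      refine (mul_eq_zero.1 ?_).resolve_right hdet
      linear_combination x₀ ^ q ^ I * (hb.symm.trans h2)
        - α * y₀ ^ q ^ J * (ha.symm.trans h1)
    exact hcd.elim (· hc) (· hd)
  let p : Polynomial L := Polynomial.C a * Polynomial.X ^ q ^ I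
    + Polynomial.C b * Polynomial.X ^ q ^ J - Polynomial.C e * Polynomial.X
  have hqI : q ^ I ≠ 1 := (Nat.one_lt_pow hI.ne' hq1).ne'
  have hqJ : q ^ J ≠ 1 := (Nat.one_lt_pow hJ.ne' hq1).ne'
  have hqIJ : q ^ I ≠ q ^ J := fun h => hIJ (Nat.pow_right_injective hq1 h)
  have hp : p ≠ 0 := by
    intro h
    have h1 := congrArg (Polynomial.coeff · (q ^ I)) h
    have h2 := congrArg (Polynomial.coeff · (q ^ J)) h
    simp [p, Polynomial.coeff_X_pow, Polynomial.coeff_X, hqI.symm, hqIJ] at h1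
    simp [p, Polynomial.coeff_X_pow, Polynomial.coeff_X, hqJ.symm, hqIJ.symm] at h2
    exact hab.elim (· h1) (· h2)
  have hdeg : p.natDegree ≤ q ^ max I J := by
    have hq' : 0 < q := by omega
    refine (Polynomial.natDegree_sub_le _ _).trans (max_le
      ((Polynomial.natDegree_add_le _ _).trans (max_le ?_ ?_)) ?_)
    · exact (Polynomial.natDegree_C_mul_X_pow_le _ _).trans
        (Nat.pow_le_pow_right hq' (le_max_left _ _))
    · exact (Polynomial.natDegree_C_mul_X_pow_le _ _).trans
        (Nat.pow_le_pow_right hq' (le_max_right _ _))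
    · exact ((Polynomial.natDegree_C_mul_le _ _).trans Polynomial.natDegree_X_le).trans (Nat.one_le_pow _ _ hq')
  have hroot (w : ↥(Uspace q K rfl α β γ I J ⊓ V.restrictScalars K)) :
      ∃ l ∈ p.roots.toFinset, w.1 = Uvec q α β γ I J (l * x₀) (l * y₀) := by
    obtain ⟨w, ⟨x, y, rfl⟩, hwV⟩ := w
    obtain ⟨l, h0, h1, h2⟩ := hV _ hwV
    have h0 : x = l * x₀ := h0
    have h1 : y = l * y₀ := h1
    subst h0 h1
    refine ⟨l, ?_, rfl⟩
    rw [Multiset.mem_toFinset, Polynomial.mem_roots hp]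
    simp [Uvec, mul_pow] at h2
    simp [p]
    linear_combination h2
  choose f hf hfU using hroot
  have hfinj : Function.Injective fun w => (⟨f w, hf w⟩ : p.roots.toFinset) := by
    intro w w' h
    apply Subtype.ext
    have h : f w = f w' := congrArg Subtype.val h
    rw [hfU, hfU w', h]
  have hcard := Nat.card_le_card_of_injective _ hfinj
  have : Module.Finite K L := Module.Finite.of_finite
  rw [Module.natCard_eq_pow_finrank (K := K), Nat.card_eq_fintype_card,
    Nat.card_eq_fintype_card, Fintype.card_coe] at hcard
  exact (Nat.pow_le_pow_iff_right hq1).1 (hcard.trans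
    (((Multiset.toFinset_card_le _).trans (Polynomial.card_roots' p)).trans hdeg))

theorem finrank_Uspace_inf_le [Finite L] (hP : PHasNoRoot q α β γ I J) (hα : α ≠ 0)
    (hβ : β ≠ 0) (hI : 0 < I) (hJ : 0 < J) (hIJ : I ≠ J) {V : Submodule L (Fin 4 → L)}
    (hV : finrank L V ≤ 2) :
    finrank K ↥(Uspace q K rfl α β γ I J ⊓ V.restrictScalars K) ≤ max I J * 2 := by
  have hq0 : q ≠ 0 := Fintype.card_ne_zero
  let T : V →ₗ[L] (Fin 2 → L) :=
    LinearMap.pi (fun i => LinearMap.proj (![0, 1] i : Fin 4)) ∘ₗ V.subtype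
  have hTe (w : V) : T w = ![w.1 0, w.1 1] := by
    funext i
    fin_cases i <;> rfl
  by_cases hker : LinearMap.ker T = ⊥
  · obtain ⟨g, hg⟩ := T.exists_leftInverse_of_injective hker
    refine finrank_Uspace_inf_le_of_eq_graph hα hβ hI hIJ (V.subtype ∘ₗ g) fun w hw => ?_
    have := LinearMap.congr_fun hg ⟨w, hw⟩
    rw [LinearMap.comp_apply, hTe] at this
    exact congrArg Subtype.val this
  by_cases hran : LinearMap.range T = ⊥
  · have hbot : Uspace q K rfl α β γ I J ⊓ V.restrictScalars K = ⊥ := by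
      rw [eq_bot_iff]
      rintro w ⟨⟨x, y, rfl⟩, hwV⟩
      have h := hTe ⟨_, hwV⟩
      rw [LinearMap.range_eq_bot.1 hran] at h
      have hx : 0 = x := congrFun h 0
      have hy : 0 = y := congrFun h 1
      subst hx hy
      rw [Submodule.mem_bot]
      funext i
      fin_cases i <;> simp [Uvec, zero_pow (pow_ne_zero _ hq0)]
    rw [hbot]
    simp
  have hsum := T.finrank_range_add_finrank_ker
  have hk := Submodule.one_le_finrank_iff.2 hker
  have hr := Submodule.one_le_finrank_iff.2 hran
  have hk1 : finrank L (LinearMap.ker T) = 1 := by omega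
  have hr1 : finrank L (LinearMap.range T) = 1 := by omega
  obtain ⟨z, hz, hz0⟩ := Submodule.exists_mem_ne_zero_of_ne_bot hker
  obtain ⟨r, ⟨w₀, rfl⟩, hr0⟩ := Submodule.exists_mem_ne_zero_of_ne_bot hran
  have hzspan := (finrank_eq_one_iff_of_nonzero' (⟨z, hz⟩ : LinearMap.ker T)
    (fun h => hz0 (congrArg Subtype.val h))).1 hk1
  have hrspan := (finrank_eq_one_iff_of_nonzero' (⟨T w₀, w₀, rfl⟩ : LinearMap.range T)
    (fun h => hr0 (congrArg Subtype.val h))).1 hr1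
  have hTz : T z = 0 := hz
  rw [hTe] at hTz hr0
  have hz_0 : z.1 0 = 0 := congrFun hTz 0
  have hz_1 : z.1 1 = 0 := congrFun hTz 1
  refine (finrank_Uspace_inf_le_of_line (x₀ := w₀.1 0) (y₀ := w₀.1 1) (c := z.1 3)
    (d := -z.1 2) (e := z.1 3 * w₀.1 2 + -z.1 2 * w₀.1 3) hP hI hJ hIJ ?_ ?_ ?_).trans
    (by omega)
  · by_contra! h
    exact hr0 (by simp [h.1, h.2])
  · by_contra! h
    apply hz0
    apply Subtype.ext
    funext i
    fin_cases i
    · exact hz_0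
    · exact hz_1
    · exact neg_eq_zero.1 h.2
    · exact h.1
  · intro w hw
    obtain ⟨l, hl⟩ := hrspan ⟨T ⟨w, hw⟩, ⟨w, hw⟩, rfl⟩
    have hl : l • T w₀ = T ⟨w, hw⟩ := congrArg Subtype.val hl
    obtain ⟨m, hm⟩ := hzspan ⟨⟨w, hw⟩ - l • w₀, by
      rw [LinearMap.mem_ker, map_sub, map_smul, hl, sub_self]⟩
    have hm : m • z.1 = w - l • w₀.1 := congrArg (fun u => u.1.1) hm
    have hm' (i) : m * z.1 i = w i - l * w₀.1 i := congrFun hm i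
    refine ⟨l, ?_, ?_, ?_⟩
    · have := hm' 0
      rw [hz_0] at this
      linear_combination -this
    · have := hm' 1
      rw [hz_1] at this
      linear_combination -this
    · linear_combination z.1 2 * hm' 3 - z.1 3 * hm' 2

end Uspace

/-- A polynomial without roots acquires none in an extension of prime degree exceeding its
degree. -/
theorem aeval_ne_zero_of_natDegree_lt_prime {k L : Type*} [Field k] [Field L] [Algebra k L]
    {p : Polynomial k} (hroot : ∀ x, p.eval x ≠ 0) (hprime : (finrank k L).Prime)
    (hdeg : p.natDegree < finrank k L) (s : L) : Polynomial.aeval s p ≠ 0 := by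
  intro hs
  have hp : p ≠ 0 := by
    rintro rfl
    exact hroot 0 (by simp)
  have : FiniteDimensional k L := Module.finite_of_finrank_pos hprime.pos
  have hdvd := minpoly.degree_dvd (IsIntegral.of_finite k s)
  have hle : (minpoly k s).natDegree ≤ p.natDegree :=
    Polynomial.natDegree_le_natDegree (minpoly.degree_le_of_ne_zero k s hp hs)
  rcases (Nat.dvd_prime hprime).1 hdvd with h | h
  · obtain ⟨x, rfl⟩ := minpoly.natDegree_eq_one_iff.1 h
    rw [Polynomial.aeval_algebraMap_apply] at hs
    exact hroot x (by simpa using hs)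
  · omega

theorem PHasNoRoot.map {q : ℕ} (hq : 1 < q) {k L : Type*} [Field k] [Field L] [Algebra k L]
    {α β γ : k} {I J : ℕ} (hP : PHasNoRoot q α β γ I J) (hprime : (finrank k L).Prime)
    (hdeg : q ^ (I + J) + 1 < finrank k L) :
    PHasNoRoot q (algebraMap k L α) (algebraMap k L β) (algebraMap k L γ) I J := by
  have hq' : 0 < q := by omega
  unfold PHasNoRoot at hP ⊢
  split_ifs at hP ⊢ with h
  · intro s
    let p : Polynomial k := Polynomial.X ^ (q ^ (J - I) + 1)
      + Polynomial.C γ * Polynomial.X - Polynomial.C (α * β)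
    have hp : p.natDegree ≤ q ^ (J - I) + 1 := by
      have : 0 < q ^ (J - I) := by positivity
      simp only [p]
      compute_degree
    have hle : q ^ (J - I) ≤ q ^ (I + J) := Nat.pow_le_pow_right hq' (by omega)
    have := aeval_ne_zero_of_natDegree_lt_prime (p := p) (fun x => by simpa [p] using hP x)
      hprime (by omega) s
    simpa [p] using this
  · intro s
    let p : Polynomial k := Polynomial.X ^ (q ^ (I - J) + 1)
      + Polynomial.C γ * Polynomial.X ^ q ^ (I - J) - Polynomial.C (α * β)
    have hp : p.natDegree ≤ q ^ (I - J) + 1 := by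
      simp only [p]
      compute_degree
    have hle : q ^ (I - J) ≤ q ^ (I + J) := Nat.pow_le_pow_right hq' (by omega)
    have := aeval_ne_zero_of_natDegree_lt_prime (p := p) (fun x => by simpa [p] using hP x)
      hprime (by omega) s
    simpa [p] using this

end ScatteredSeq

/-- Assume gcd(I,J,n) = 1, I ≠ J, and that P^{I,J}_{α,β,γ}(X) has
no roots in F_{q^n}.  Then for infinitely many positive integers ℓ, the F_q-subspace
U_ℓ = {(x, y, x^{q^I} + αy^{q^J}, x^{q^J} + βy^{q^I} + γy^{q^J}) : x, y ∈ F_{q^{nℓ}}}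
of F_{q^{nℓ}}^4 is scattered and indecomposable (no splitting of F_{q^{nℓ}}^4 into
nonzero F_{q^{nℓ}}-subspaces V₁ ⊕ V₂ with U_ℓ = (U_ℓ ∩ V₁) + (U_ℓ ∩ V₂) and both
dim_{F_q}(U_ℓ ∩ Vᵢ) positive multiples of nℓ).  A degree-ℓ extension of F_{q^n} is
formalized as any field L with Algebra F_{q^n} L and dim_{F_{q^n}} L = ℓ. -/
theorem Uspace_exceptional_scattered_indecomposable
    (q n : ℕ) (Fq Fqn : Type*) [Field Fq] [Fintype Fq] [Field Fqn] [Algebra Fq Fqn]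
    (hq : Fintype.card Fq = q) (hrank : Module.finrank Fq Fqn = n)
    (α β γ : Fqn) (hα : α ≠ 0) (hβ : β ≠ 0) (hγ : γ ≠ 0)
    (I J : ℕ) (hI : 0 < I) (hJ : 0 < J) (hIJ : I ≠ J) (hIn : I < n - 1) (hJn : J < n - 1)
    (hgcd : Nat.gcd (Nat.gcd I J) n = 1)
    (hP : PHasNoRoot q α β γ I J) :
    {ℓ : ℕ | 0 < ℓ ∧
      ∀ (L : Type*) [Field L] [Algebra Fq L] [Algebra Fqn L] [IsScalarTower Fq Fqn L],
        Module.finrank Fqn L = ℓ →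
          (IsScattered Fq (Uspace q Fq hq (algebraMap Fqn L α) (algebraMap Fqn L β)
              (algebraMap Fqn L γ) I J) ∧
            ¬ ∃ V₁ V₂ : Submodule L (Fin 4 → L),
              V₁ ≠ ⊥ ∧ V₂ ≠ ⊥ ∧ IsCompl V₁ V₂ ∧
              Uspace q Fq hq (algebraMap Fqn L α) (algebraMap Fqn L β)
                  (algebraMap Fqn L γ) I J
                = Uspace q Fq hq (algebraMap Fqn L α) (algebraMap Fqn L β)
                    (algebraMap Fqn L γ) I J ⊓ V₁.restrictScalars Fq
                  ⊔ Uspace q Fq hq (algebraMap Fqn L α) (algebraMap Fqn L β)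
                      (algebraMap Fqn L γ) I J ⊓ V₂.restrictScalars Fq ∧
              (∃ a : ℕ, 0 < a ∧
                Module.finrank Fq ↥(Uspace q Fq hq (algebraMap Fqn L α)
                  (algebraMap Fqn L β) (algebraMap Fqn L γ) I J ⊓ V₁.restrictScalars Fq)
                  = a * (n * ℓ)) ∧
              (∃ b : ℕ, 0 < b ∧
                Module.finrank Fq ↥(Uspace q Fq hq (algebraMap Fqn L α)
                  (algebraMap Fqn L β) (algebraMap Fqn L γ) I J ⊓ V₂.restrictScalars Fq)
                  = b * (n * ℓ)))}.Infinite := by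
  subst hq
  have hq1 : 1 < Fintype.card Fq := Fintype.one_lt_card
  refine Set.infinite_of_not_bddAbove ?_
  rintro ⟨B, hB⟩
  obtain ⟨ℓ, hle, hprime⟩ :=
    Nat.exists_infinite_primes (B + Fintype.card Fq ^ (I + J) + I + 2)
  refine absurd (hB (a := ℓ) ⟨hprime.pos, ?_⟩) (by omega)
  intro L _ _ _ _ hL
  have hfin : finrank Fq L = n * ℓ := by rw [← finrank_mul_finrank Fq Fqn L, hrank, hL]
  have hpos : 0 < n * ℓ := Nat.mul_pos (by omega) hprime.pos
  have : Module.Finite Fq L := Module.finite_of_finrank_pos (hfin ▸ hpos)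
  have : Finite L := Module.finite_of_finite Fq
  have hPL := hP.map (L := L) hq1 (hL ▸ hprime) (by omega)
  have hαL : algebraMap Fqn L α ≠ 0 := by simpa using hα
  have hβL : algebraMap Fqn L β ≠ 0 := by simpa using hβ
  refine ⟨isScattered_Uspace hPL ?_, ?_⟩
  · have hcop : Nat.Coprime (Nat.gcd I J) ℓ := Nat.Coprime.coprime_dvd_left
      (Nat.gcd_dvd_left I J)
      ((hprime.coprime_iff_not_dvd.2 (Nat.not_dvd_of_pos_of_lt hI (by omega))).symm)
    rw [hfin]
    exact Nat.Coprime.mul_right hgcd hcop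
  · rintro ⟨V₁, V₂, -, -, hcompl, -, ⟨a, ha, ha'⟩, ⟨b, hb, hb'⟩⟩
    have hsum := Submodule.finrank_add_eq_of_isCompl hcompl
    rw [finrank_fin_fun] at hsum
    have h2n : n * 2 ≤ n * ℓ := Nat.mul_le_mul_left n hprime.two_le
    rcases (by omega : finrank L V₁ ≤ 2 ∨ finrank L V₂ ≤ 2) with h | h
    · have h1 := finrank_Uspace_inf_le (K := Fq) hPL hαL hβL hI hJ hIJ h
      rw [ha'] at h1
      have h2 := Nat.le_mul_of_pos_left (n * ℓ) ha
      omega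
    · have h1 := finrank_Uspace_inf_le (K := Fq) hPL hαL hβL hI hJ hIJ h
      rw [hb'] at h1
      have h2 := Nat.le_mul_of_pos_left (n * ℓ) hb
      omega
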